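/- arXiv:2209.12832 — 3 statements merged into one kernel-verified Lean document; each statement's English description precedes it below -/
import Mathlib

section
/- Let λ > 0 be a real number, μ a complex number with Re μ ≥ 0, and z a complex number with Im z > 0; set s = 1/2 − iz. Then −∫₀^∞ λ [ Φ(1, 2, λ/2 + μ) − e^{−t(1/2 + μ/λ)} Φ(e^{−t/λ}, 2, λ/2 + μ) ] e^{izt} dt = (1/z²) [ ψ(λs + μ) − ψ(λ/2 + μ) ], where ψ(w) = Γ'(w)/Γ(w) is the logarithmic derivative of the complex Gamma function. -/
open MeasureTheory

/-- The Lerch transcendent with second argument `2`: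
`Φ(w, 2, a) = Σ_{n=0}^∞ wⁿ/(n + a)²`. -/
noncomputable def lerchPhiTwo (w a : ℂ) : ℂ := ∑' n : ℕ, w ^ n / ((n : ℂ) + a) ^ 2

open Filter Topology Metric Set in
/-- A uniformly bounded sequence of holomorphic functions which converges pointwise on a circle to
a holomorphic function has convergent derivatives at the centre. -/
theorem tendsto_deriv_of_norm_le {F : ℕ → ℂ → ℂ} {g : ℂ → ℂ} {U : Set ℂ} (hU : IsOpen U)
    {x : ℂ} {r M : ℝ} (hr : 0 < r) (hxr : closedBall x r ⊆ U)
    (hF : ∀ᶠ n in atTop, DifferentiableOn ℂ (F n) U) (hg : DifferentiableOn ℂ g U)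
    (hM : ∀ᶠ n in atTop, ∀ w ∈ sphere x r, ‖F n w‖ ≤ M)
    (hlim : ∀ w ∈ sphere x r, Tendsto (fun n ↦ F n w) atTop (𝓝 (g w))) :
    Tendsto (fun n ↦ deriv (F n) x) atTop (𝓝 (deriv g x)) := by
  have hmem (θ : ℝ) : circleMap x r θ ∈ sphere x r := circleMap_mem_sphere x hr.le θ
  have key : Tendsto (fun n ↦ Complex.cderiv r (F n) x) atTop (𝓝 (Complex.cderiv r g x)) := by
    refine Tendsto.const_smul ?_ _
    refine intervalIntegral.tendsto_integral_filter_of_dominated_convergence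
      (fun _ ↦ r * (r ^ 2)⁻¹ * M) ?_ ?_ intervalIntegrable_const ?_
    · filter_upwards [hF] with n hn
      refine Continuous.aestronglyMeasurable ?_
      have h1 : Continuous fun θ ↦ F n (circleMap x r θ) :=
        hn.continuousOn.comp_continuous (continuous_circleMap x r)
          fun θ ↦ hxr (sphere_subset_closedBall (hmem θ))
      have h2 : Continuous fun θ ↦ ((circleMap x r θ - x) ^ 2)⁻¹ := by
        refine Continuous.inv₀ (by fun_prop) fun θ ↦ ?_
        simpa [circleMap] using hr.ne'
      have h3 : Continuous fun θ ↦ deriv (circleMap x r) θ := by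
        simp only [deriv_circleMap]
        fun_prop
      exact h3.smul (h2.smul h1)
    · filter_upwards [hM] with n hn
      refine MeasureTheory.ae_of_all _ fun θ _ ↦ ?_
      have hMn := hn _ (hmem θ)
      simp only [deriv_circleMap, smul_eq_mul, norm_mul, norm_inv, norm_pow, norm_circleMap_zero,
        Complex.norm_I, circleMap_sub_center, abs_of_pos hr, mul_one, ← mul_assoc]
      gcongr
    · exact MeasureTheory.ae_of_all _ fun θ _ ↦ ((hlim _ (hmem θ)).const_smul _).const_smul _
  rw [Complex.cderiv_eq_deriv hU hg hr hxr] at key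
  refine key.congr' ?_
  filter_upwards [hF] with n hn
  exact Complex.cderiv_eq_deriv hU hn hr hxr

namespace Complex

open Filter Topology Metric Set

theorem norm_GammaSeq_le {s : ℂ} (hs : 0 < s.re) {n : ℕ} (hn : n ≠ 0) :
    ‖GammaSeq s n‖ ≤ Real.Gamma s.re := by
  have hint := Real.GammaIntegral_convergent hs
  rw [GammaSeq_eq_approx_Gamma_integral hs hn, Real.Gamma_eq_integral hs,
    intervalIntegral.integral_of_le n.cast_nonneg]
  calc ‖∫ x : ℝ in Ioc 0 (n : ℝ), ((1 - x / n) ^ n : ℝ) * (x : ℂ) ^ (s - 1)‖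
      ≤ ∫ x : ℝ in Ioc 0 (n : ℝ), Real.exp (-x) * x ^ (s.re - 1) := by
        refine MeasureTheory.norm_integral_le_of_norm_le (hint.mono_set Ioc_subset_Ioi_self) ?_
        refine (MeasureTheory.ae_restrict_iff' measurableSet_Ioc).2 (.of_forall fun x hx ↦ ?_)
        have hx1 : x / n ≤ 1 := div_le_one_of_le₀ hx.2 n.cast_nonneg
        rw [norm_mul, Complex.norm_of_nonneg (pow_nonneg (sub_nonneg.2 hx1) _),
          norm_cpow_eq_rpow_re_of_pos hx.1, sub_re, one_re]
        gcongr
        · exact Real.rpow_nonneg hx.1.le _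
        · exact Real.one_sub_div_pow_le_exp_neg hx.2
    _ ≤ ∫ x : ℝ in Ioi 0, Real.exp (-x) * x ^ (s.re - 1) := by
        refine MeasureTheory.setIntegral_mono_set hint ?_ Ioc_subset_Ioi_self.eventuallyLE
        refine (MeasureTheory.ae_restrict_iff' measurableSet_Ioi).2 (.of_forall fun x hx ↦ ?_)
        have hx0 : (0 : ℝ) < x := hx
        simp only [Pi.zero_apply]
        positivity

theorem add_natCast_ne_zero_of_re_pos {s : ℂ} (hs : 0 < s.re) (j : ℕ) : s + j ≠ 0 := by
  intro h
  have := congrArg re h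
  simp only [add_re, natCast_re, zero_re] at this
  have : (0 : ℝ) ≤ j := j.cast_nonneg
  linarith

theorem differentiableAt_GammaSeq {s : ℂ} (hs : 0 < s.re) {n : ℕ} (hn : n ≠ 0) :
    DifferentiableAt ℂ (fun s ↦ GammaSeq s n) s := by
  have hn' : (n : ℂ) ≠ 0 := Nat.cast_ne_zero.2 hn
  unfold GammaSeq
  refine .fun_div (.mul_const (.const_cpow differentiableAt_id (.inl hn')) _)
    (.fun_finsetProd fun j _ ↦ by fun_prop) ?_
  exact Finset.prod_ne_zero_iff.2 fun j _ ↦ add_natCast_ne_zero_of_re_pos hs j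

theorem logDeriv_GammaSeq {s : ℂ} (hs : 0 < s.re) {n : ℕ} (hn : n ≠ 0) :
    logDeriv (fun s ↦ GammaSeq s n) s
      = log n - ∑ j ∈ Finset.range (n + 1), 1 / (s + j) := by
  have hn' : (n : ℂ) ≠ 0 := Nat.cast_ne_zero.2 hn
  have hj (j : ℕ) := add_natCast_ne_zero_of_re_pos hs j
  have hpow : HasDerivAt (fun s : ℂ ↦ (n : ℂ) ^ s) ((n : ℂ) ^ s * log n) s := by
    simpa using (hasDerivAt_id s).const_cpow (.inl hn')
  have hpow0 : (n : ℂ) ^ s ≠ 0 := by simp [cpow_eq_zero_iff, hn']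
  unfold GammaSeq
  rw [logDeriv_div (f := fun s : ℂ ↦ (n : ℂ) ^ s * (n.factorial : ℂ))
      (g := fun s : ℂ ↦ ∏ j ∈ Finset.range (n + 1), (s + j)),
    logDeriv_mul_const, logDeriv_prod]
  · congr 1
    · rw [logDeriv_apply, hpow.deriv]
      field_simp
    · refine Finset.sum_congr rfl fun j _ ↦ ?_
      simp [logDeriv_apply]
  · exact fun j _ ↦ hj j
  · exact fun j _ ↦ by fun_prop
  · exact_mod_cast n.factorial_ne_zero
  · exact mul_ne_zero hpow0 (by exact_mod_cast n.factorial_ne_zero)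
  · exact Finset.prod_ne_zero_iff.2 fun j _ ↦ hj j
  · exact hpow.differentiableAt.mul_const _
  · exact .fun_finsetProd fun j _ ↦ by fun_prop

theorem tendsto_logDeriv_GammaSeq {s : ℂ} (hs : 0 < s.re) :
    Tendsto (fun n : ℕ ↦ log n - ∑ j ∈ Finset.range (n + 1), 1 / (s + j)) atTop
      (𝓝 (digamma s)) := by
  have hre {w : ℂ} (hw : w ∈ closedBall s (s.re / 2)) : 0 < w.re := by
    rw [mem_closedBall, dist_eq] at hw
    have := (abs_le.1 ((abs_re_le_norm (w - s)).trans hw)).1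
    rw [sub_re] at this
    linarith
  have hGamma {w : ℂ} (hw : 0 < w.re) : DifferentiableAt ℂ Gamma w :=
    differentiableAt_Gamma w fun m h ↦ add_natCast_ne_zero_of_re_pos hw m (by simp [h])
  obtain ⟨M, hM⟩ := (isCompact_sphere s (s.re / 2)).exists_bound_of_continuousOn
    (f := fun w : ℂ ↦ Real.Gamma w.re) <| Real.differentiableOn_Gamma_Ioi.continuousOn.comp
      continuous_re.continuousOn fun w hw ↦ hre (sphere_subset_closedBall hw)
  have hderiv := tendsto_deriv_of_norm_le (F := fun n s ↦ GammaSeq s n) (g := Gamma)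
    (U := {w | 0 < w.re}) (M := M) (isOpen_lt continuous_const continuous_re) (half_pos hs)
    (fun w hw ↦ hre hw)
    ((eventually_ne_atTop 0).mono fun n hn w hw ↦
      (differentiableAt_GammaSeq hw hn).differentiableWithinAt)
    (fun w hw ↦ (hGamma hw).differentiableWithinAt)
    ((eventually_ne_atTop 0).mono fun n hn w hw ↦
      (norm_GammaSeq_le (hre (sphere_subset_closedBall hw)) hn).trans
        ((le_abs_self _).trans (hM w hw)))
    (fun w _ ↦ GammaSeq_tendsto_Gamma w)
  refine (hderiv.div (GammaSeq_tendsto_Gamma s) (Gamma_ne_zero_of_re_pos hs)).congr' ?_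
  filter_upwards [eventually_ne_atTop 0] with n hn
  exact logDeriv_GammaSeq hs hn

theorem tendsto_sum_digamma_sub {a b : ℂ} (ha : 0 < a.re) (hb : 0 < b.re) :
    Tendsto (fun n : ℕ ↦ ∑ j ∈ Finset.range n, (1 / (a + j) - 1 / (b + j))) atTop
      (𝓝 (digamma b - digamma a)) := by
  rw [← tendsto_add_atTop_iff_nat 1]
  refine ((tendsto_logDeriv_GammaSeq hb).sub (tendsto_logDeriv_GammaSeq ha)).congr fun n ↦ ?_
  rw [Finset.sum_sub_distrib]
  ring

theorem summable_inv_norm_natCast_add_sq {a : ℂ} (ha : 0 < a.re) :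
    Summable fun n : ℕ ↦ (‖(n : ℂ) + a‖ ^ 2)⁻¹ := by
  refine ((Real.summable_one_div_nat_add_rpow a.re 2).2 one_lt_two).of_nonneg_of_le
    (fun n ↦ by positivity) fun n ↦ ?_
  have hpos : 0 < (n : ℝ) + a.re := by positivity
  rw [one_div, abs_of_pos hpos, Real.rpow_two]
  gcongr
  simpa using re_le_norm ((n : ℂ) + a)

end Complex

theorem summable_lerchPhiTwo {w a : ℂ} (hw : ‖w‖ ≤ 1) (ha : 0 < a.re) :
    Summable fun n : ℕ ↦ w ^ n / ((n : ℂ) + a) ^ 2 := by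
  refine (Complex.summable_inv_norm_natCast_add_sq ha).of_norm_bounded fun n ↦ ?_
  rw [norm_div, norm_pow, norm_pow, div_eq_mul_inv]
  exact mul_le_of_le_one_left (by positivity) (pow_le_one₀ (norm_nonneg _) hw)

open Complex in
theorem integral_one_sub_exp_mul_exp {c u : ℂ} (hc : 0 < c.re) (hu : u.re < 0) :
    ∫ t : ℝ in Set.Ioi 0, (1 - exp (-c * t)) * exp (u * t) = 1 / (u - c) - 1 / u := by
  have huc : (u - c).re < 0 := by
    rw [sub_re]
    linarith
  have hexp (t : ℝ) : (1 - exp (-c * t)) * exp (u * t) = exp (u * t) - exp ((u - c) * t) := by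
    rw [sub_mul, one_mul, ← exp_add]
    ring_nf
  simp_rw [hexp]
  rw [integral_sub (integrableOn_exp_mul_complex_Ioi hu 0)
    (integrableOn_exp_mul_complex_Ioi huc 0), integral_exp_mul_complex_Ioi hu,
    integral_exp_mul_complex_Ioi huc]
  simp
  ring

/-- For a real `λ > 0`, `μ` with `Re μ ≥ 0`, and `z` with `Im z > 0`,
setting `s = 1/2 − iz`,
`−∫₀^∞ λ [ Φ(1,2,λ/2+μ) − e^{−t(1/2+μ/λ)} Φ(e^{−t/λ},2,λ/2+μ) ] e^{izt} dt
  = (1/z²)[ ψ(λs+μ) − ψ(λ/2+μ) ]` where `ψ = Γ'/Γ`. -/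
theorem integral_lerch_digamma (lam : ℝ) (hlam : 0 < lam) (μ : ℂ) (hμ : 0 ≤ μ.re)
    (z : ℂ) (hz : 0 < z.im) (s : ℂ) (hs : s = 1 / 2 - Complex.I * z) :
    -(∫ t in Set.Ioi (0 : ℝ),
        (lam : ℂ) * (lerchPhiTwo 1 ((lam : ℂ) / 2 + μ)
            - Complex.exp (-(t : ℂ) * (1 / 2 + μ / (lam : ℂ))) *
                lerchPhiTwo (Complex.exp (-(t : ℂ) / (lam : ℂ))) ((lam : ℂ) / 2 + μ)) *
          Complex.exp (Complex.I * z * t))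
      = 1 / z ^ 2 *
          (deriv Complex.Gamma ((lam : ℂ) * s + μ) / Complex.Gamma ((lam : ℂ) * s + μ)
            - deriv Complex.Gamma ((lam : ℂ) / 2 + μ) / Complex.Gamma ((lam : ℂ) / 2 + μ)) := by
  have hlam' : (lam : ℂ) ≠ 0 := Complex.ofReal_ne_zero.2 hlam.ne'
  obtain ⟨a, ha_def⟩ : ∃ a : ℂ, a = (lam : ℂ) / 2 + μ := ⟨_, rfl⟩
  have ha : 0 < a.re := by
    have : a.re = lam / 2 + μ.re := by
      simp [ha_def]
    rw [this]
    positivity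
  have hu : (Complex.I * z).re < 0 := by simpa using hz
  have hz0 : z ≠ 0 := fun h ↦ by simp [h] at hz
  have hb_def : (lam : ℂ) * s + μ = a - lam * (Complex.I * z) := by
    rw [hs, ha_def]
    ring
  have hb : 0 < (a - lam * (Complex.I * z)).re := by
    have : (a - lam * (Complex.I * z)).re = a.re + lam * z.im := by
      simp
    rw [this]
    positivity
  have hexp (t : ℝ) : Complex.exp (-(t : ℂ) * (1 / 2 + μ / (lam : ℂ)))
      = Complex.exp (-(t : ℂ) * (a / lam)) := by
    rw [ha_def]
    congr 2
    field_simp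
  rw [← ha_def, hb_def]
  simp_rw [hexp]
  have hc (n : ℕ) : 0 < (((n : ℂ) + a) / lam).re := by
    rw [Complex.div_ofReal_re, Complex.add_re, Complex.natCast_re]
    positivity
  let F (n : ℕ) (t : ℝ) : ℂ := (lam : ℂ) / ((n : ℂ) + a) ^ 2 *
    ((1 - Complex.exp (-(((n : ℂ) + a) / lam) * t)) * Complex.exp (Complex.I * z * t))
  have hbound (n : ℕ) (t : ℝ) (ht : t ∈ Set.Ioi (0 : ℝ)) :
      ‖F n t‖ ≤ lam * (‖(n : ℂ) + a‖ ^ 2)⁻¹ * 2 * Real.exp (-z.im * t) := by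
    have ht0 : (0 : ℝ) < t := ht
    have h1 : ‖1 - Complex.exp (-(((n : ℂ) + a) / lam) * t)‖ ≤ 2 := by
      refine (norm_sub_le _ _).trans ?_
      have : ‖Complex.exp (-(((n : ℂ) + a) / lam) * t)‖ ≤ 1 := by
        rw [Complex.norm_exp, Real.exp_le_one_iff, Complex.re_mul_ofReal, Complex.neg_re]
        nlinarith [mul_pos (hc n) ht0]
      rw [norm_one]
      linarith
    have h2 : ‖Complex.exp (Complex.I * z * t)‖ = Real.exp (-z.im * t) := by
      rw [Complex.norm_exp, Complex.re_mul_ofReal]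
      simp
    simp only [F, norm_mul, norm_div, norm_pow, h2, Complex.norm_real, Real.norm_of_nonneg hlam.le]
    rw [div_eq_mul_inv, mul_assoc _ (2 : ℝ)]
    gcongr
  have hdom : IntegrableOn (fun t : ℝ ↦ Real.exp (-z.im * t)) (Set.Ioi 0) :=
    integrableOn_exp_mul_Ioi (neg_lt_zero.2 hz) 0
  have hFint (n : ℕ) : IntegrableOn (F n) (Set.Ioi 0) := by
    refine Integrable.mono' (hdom.const_mul (lam * (‖(n : ℂ) + a‖ ^ 2)⁻¹ * 2))
      (Continuous.aestronglyMeasurable (by fun_prop)) ?_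
    exact (ae_restrict_iff' measurableSet_Ioi).2 (.of_forall (hbound n))
  have hFsum : Summable fun n ↦ ∫ t in Set.Ioi (0 : ℝ), ‖F n t‖ := by
    refine Summable.of_nonneg_of_le (fun n ↦ integral_nonneg fun t ↦ norm_nonneg _) (fun n ↦
      setIntegral_mono_on (hFint n).norm (hdom.const_mul _) measurableSet_Ioi (hbound n)) ?_
    simp_rw [integral_const_mul]
    exact (((Complex.summable_inv_norm_natCast_add_sq ha).mul_left lam).mul_right 2).mul_right _
  have hsum := (hasSum_integral_of_summable_integral_norm hFint hFsum).tendsto_sum_nat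
  have htsum (t : ℝ) (ht : t ∈ Set.Ioi (0 : ℝ)) : ∑' n, F n t =
      (lam : ℂ) * (lerchPhiTwo 1 a - Complex.exp (-(t : ℂ) * (a / lam)) *
        lerchPhiTwo (Complex.exp (-(t : ℂ) / (lam : ℂ))) a) * Complex.exp (Complex.I * z * t) := by
    have ht0 : (0 : ℝ) < t := ht
    have hw : ‖Complex.exp (-(t : ℂ) / (lam : ℂ))‖ ≤ 1 := by
      rw [Complex.norm_exp, Real.exp_le_one_iff, Complex.div_ofReal_re, Complex.neg_re,
        Complex.ofReal_re, neg_div]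
      exact neg_nonpos.2 (by positivity)
    have hS := (((summable_lerchPhiTwo (w := 1) (by simp) ha).hasSum.sub
      ((summable_lerchPhiTwo hw ha).hasSum.mul_left
        (Complex.exp (-(t : ℂ) * (a / lam))))).mul_left (lam : ℂ)).mul_right
          (Complex.exp (Complex.I * z * t))
    refine (hS.congr_fun ?_).tsum_eq
    intro n
    have hpow : Complex.exp (-(((n : ℂ) + a) / lam) * t) =
        Complex.exp (-(t : ℂ) * (a / lam)) * Complex.exp (-(t : ℂ) / (lam : ℂ)) ^ n := by
      rw [← Complex.exp_nat_mul, ← Complex.exp_add]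
      congr 1
      ring
    simp only [F, hpow, one_pow]
    ring
  have hterm (n : ℕ) : ∫ t in Set.Ioi (0 : ℝ), F n t =
      -(1 / z ^ 2) * (1 / (a + n) - 1 / (a - lam * (Complex.I * z) + n)) := by
    have h1 : a + n ≠ 0 := Complex.add_natCast_ne_zero_of_re_pos ha n
    have h2 := Complex.add_natCast_ne_zero_of_re_pos hb n
    have h3 : Complex.I * z - ((n : ℂ) + a) / lam =
        -(a - lam * (Complex.I * z) + n) / lam := by
      field_simp
      ring
    simp only [F]
    rw [integral_const_mul, integral_one_sub_exp_mul_exp (hc n) hu, h3, add_comm (n : ℂ) a]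
    generalize hB : a - lam * (Complex.I * z) + n = B at *
    have hA : a + n = B + lam * (Complex.I * z) := by
      rw [← hB]
      ring
    rw [hA] at h1 ⊢
    have hu0 : Complex.I * z ≠ 0 := mul_ne_zero Complex.I_ne_zero hz0
    have hz2 : z ^ 2 = -(Complex.I * z) ^ 2 := by
      rw [mul_pow, Complex.I_sq]
      ring
    rw [hz2]
    generalize Complex.I * z = u at h1 hu0 ⊢
    field_simp
    ring
  simp_rw [hterm, ← Finset.mul_sum] at hsum
  rw [← setIntegral_congr_fun measurableSet_Ioi htsum,
    tendsto_nhds_unique hsum ((Complex.tendsto_sum_digamma_sub ha hb).const_mul _)]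
  simp [Complex.digamma_def, logDeriv_apply]
end

section
/- Let ξ : ℂ → ℂ be an entire function and ω a complex number with |ω| = 1 such that ξ(s) = ω · conj(ξ(1 − conj(s))) for all complex s. Let A be a complex number, B a real number, m₀ a natural number, θ ≥ 0, and (γₖ)_{k∈I} a countable family of nonzero complex numbers with (1/|γₖ|²)_{k∈I} summable and |Im γₖ| ≤ θ for all k, such that ξ(1/2 − iz) = e^{A + Bz} z^{m₀} Πₖ (1 − z/γₖ) e^{z/γₖ} for every complex z (the products being multipliable). Assume moreover that Re γₖ ≠ 0 for every k (i.e. ξ has no real zeros except possibly at s = 1/2). Then all γₖ are real if and only if there exists t₀ ≥ 0 such that Re(−g(t)) ≥ 0 for all t ≥ t₀, where g(t) = −iBt − (m₀/2)t² + Σₖ (e^{−iγₖ t} − 1)/γₖ². -/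
open MeasureTheory ProbabilityTheory Filter Topology Set

/-- A left half-plane with countably many points removed is connected. -/
lemma isPreconnected_re_lt_diff_countable (a : ℝ) {P : Set ℂ} (hP : P.Countable) :
    IsPreconnected ({z : ℂ | z.re < a} \ P) := by
  let φ : ℂ → ℂ := fun z => ((a - Real.exp z.re : ℝ) : ℂ) + (z.im : ℂ) * Complex.I
  have hφ : Continuous φ := by fun_prop
  have hinj : Function.Injective φ := by
    intro z w h
    have h1 := congrArg Complex.re h
    have h2 := congrArg Complex.im h
    simp [φ, -Complex.ofReal_exp, -Complex.ofReal_sub] at h1 h2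
    exact Complex.ext h1 h2
  have hconn : IsPreconnected (φ ⁻¹' P)ᶜ :=
    ((hP.preimage_of_injOn hinj.injOn).isConnected_compl_of_one_lt_rank (by simp)).isPreconnected
  have himg : φ '' (φ ⁻¹' P)ᶜ = {z : ℂ | z.re < a} \ P := by
    ext w
    constructor
    · rintro ⟨z, hz, rfl⟩
      refine ⟨?_, hz⟩
      simp [φ, -Complex.ofReal_exp, -Complex.ofReal_sub, Real.exp_pos]
    · rintro ⟨hw, hwP⟩
      have hw' : 0 < a - w.re := sub_pos.mpr hw
      have hz : φ ⟨Real.log (a - w.re), w.im⟩ = w := by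
        apply Complex.ext
        · simp [φ, -Complex.ofReal_exp, -Complex.ofReal_sub, Real.exp_log hw']
        · simp [φ, -Complex.ofReal_exp, -Complex.ofReal_sub]
      exact ⟨_, by simpa [hz] using hwP, hz⟩
  rw [← himg]
  exact hconn.image φ hφ.continuousOn

/-- Landau's lemma for the moment generating function of a measure on the half-line: if the
complex moment generating function extends holomorphically to a disc around a real point `c`, then
it converges absolutely at every real point of the disc to the right of `c`. -/
lemma add_mem_integrableExpSet_of_differentiableOn_ball {μ : Measure ℝ}
    (hμ : ∀ᵐ x ∂μ, 0 ≤ x) {c R r : ℝ} (hc : c ∈ interior (integrableExpSet id μ)) {G : ℂ → ℂ}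
    (hG : DifferentiableOn ℂ G (Metric.ball (c : ℂ) R))
    (hFG : complexMGF id μ =ᶠ[𝓝 (c : ℂ)] G) (hr0 : 0 ≤ r) (hr : r < R) :
    c + r ∈ integrableExpSet id μ := by
  have hcC : (c : ℂ).re ∈ interior (integrableExpSet id μ) := by simpa using hc
  have hz : ((c + r : ℝ) : ℂ) ∈ Metric.ball (c : ℂ) R := by
    simpa [abs_of_nonneg hr0] using hr
  have hs := (Complex.hasSum_taylorSeries_on_ball hG hz).summable
  let f : ℕ → ℝ → ℝ := fun n x => ((n.factorial : ℝ)⁻¹ * r ^ n) * (x ^ n * Real.exp (c * x))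
  have hfint : ∀ n, Integrable (f n) μ := fun n =>
    (integrable_pow_mul_exp_of_mem_interior_integrableExpSet hc n).const_mul _
  have hcoef : ∀ n, ((∫ x, f n x ∂μ : ℝ) : ℂ) =
      (n.factorial : ℂ)⁻¹ • (((c + r : ℝ) : ℂ) - c) ^ n • iteratedDeriv n G c := by
    intro n
    rw [← hFG.iteratedDeriv_eq n, iteratedDeriv_complexMGF hcC n]
    simp only [f, integral_const_mul, smul_eq_mul]
    push_cast
    rw [← integral_complex_ofReal]
    simp [mul_assoc]
  have hsumR : Summable fun n => ∫ x, f n x ∂μ := by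
    rw [← Complex.summable_ofReal]
    exact hs.congr fun n => (hcoef n).symm
  have hnn : ∀ n, ∀ᵐ x ∂μ, 0 ≤ f n x := by
    intro n
    filter_upwards [hμ] with x hx
    positivity
  have hpt : ∀ x, HasSum (fun n => f n x) (Real.exp ((c + r) * x)) := by
    intro x
    have h1 := (NormedSpace.expSeries_div_hasSum_exp (r * x)).mul_left (Real.exp (c * x))
    rw [← Real.exp_eq_exp_ℝ, ← Real.exp_add] at h1
    have h2 : (fun n => f n x) = fun n : ℕ =>
        Real.exp (c * x) * ((r * x) ^ n / (n.factorial : ℝ)) := by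
      ext n
      simp only [f, mul_pow]
      ring
    rw [h2, add_mul]
    exact h1
  have hlin : ∫⁻ x, ENNReal.ofReal (Real.exp ((c + r) * x)) ∂μ
      = ∑' n, ∫⁻ x, ENNReal.ofReal (f n x) ∂μ := by
    rw [← lintegral_tsum fun n => (hfint n).aemeasurable.ennreal_ofReal]
    refine lintegral_congr_ae ?_
    filter_upwards [hμ] with x hx
    rw [← (hpt x).tsum_eq, ENNReal.ofReal_tsum_of_nonneg _ (hpt x).summable]
    intro n
    positivity
  have hfin : ∑' n, ∫⁻ x, ENNReal.ofReal (f n x) ∂μ ≠ ⊤ := by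
    simp_rw [fun n => (ofReal_integral_eq_lintegral_ofReal (hfint n) (hnn n)).symm]
    exact hsumR.tsum_ofReal_ne_top
  refine ⟨by fun_prop, ?_⟩
  rw [hasFiniteIntegral_iff_ofReal (Eventually.of_forall fun x => (Real.exp_pos _).le)]
  simp only [id]
  rw [hlin]
  exact hfin.lt_top

lemma Iio_subset_interior_integrableExpSet {μ : Measure ℝ} {σ : ℝ}
    (h : Iio σ ⊆ integrableExpSet id μ) : Iio σ ⊆ interior (integrableExpSet id μ) :=
  interior_maximal h isOpen_Iio

lemma mem_integrableExpSet_of_le {μ : Measure ℝ} (hμ : ∀ᵐ x ∂μ, 0 ≤ x) {x y : ℝ}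
    (hxy : x ≤ y) (hy : y ∈ integrableExpSet id μ) : x ∈ integrableExpSet id μ := by
  refine Integrable.mono' (integrable_of_mem_integrableExpSet hy) (by fun_prop) ?_
  filter_upwards [hμ] with t ht
  rw [Real.norm_of_nonneg (Real.exp_pos _).le]
  simp only [id]
  gcongr

lemma complexMGF_eqOn_of_differentiableOn {μ : Measure ℝ} {P : Set ℂ} (hPc : P.Countable)
    (hPcl : IsClosed P) {G : ℂ → ℂ} {a σ : ℝ} (ha : Iio a ⊆ integrableExpSet id μ)
    (hG : DifferentiableOn ℂ G ({z : ℂ | z.re < a} \ P)) (hσP : ∀ p ∈ P, σ ≤ p.re)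
    (hFG : ∀ z : ℂ, z.re < σ → complexMGF id μ z = G z) :
    EqOn (complexMGF id μ) G ({z : ℂ | z.re < a} \ P) := by
  have hopen : IsOpen ({z : ℂ | z.re < a} \ P) :=
    (isOpen_lt Complex.continuous_re continuous_const).sdiff hPcl
  have hF : AnalyticOnNhd ℂ (complexMGF id μ) ({z : ℂ | z.re < a} \ P) := fun z hz =>
    analyticAt_complexMGF (Iio_subset_interior_integrableExpSet ha hz.1)
  let z₀ : ℂ := ((min a σ - 1 : ℝ) : ℂ)
  have hz₀a : z₀.re < a := by
    simp only [z₀, Complex.ofReal_re]; linarith [min_le_left a σ]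
  have hz₀σ : z₀.re < σ := by
    simp only [z₀, Complex.ofReal_re]; linarith [min_le_right a σ]
  refine hF.eqOn_of_preconnected_of_eventuallyEq (hG.analyticOnNhd hopen)
    (isPreconnected_re_lt_diff_countable a hPc) (z₀ := z₀)
    ⟨hz₀a, fun h => (hσP _ h).not_gt hz₀σ⟩ ?_
  filter_upwards [(isOpen_lt Complex.continuous_re continuous_const).mem_nhds hz₀σ] with z hz
  exact hFG z hz

lemma Iio_zero_subset_integrableExpSet {μ : Measure ℝ} (hμ : ∀ᵐ x ∂μ, 0 ≤ x) {P : Set ℂ}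
    (hPc : P.Countable) (hPcl : IsClosed P) (hPim : ∀ p ∈ P, p.im ≠ 0) {G : ℂ → ℂ}
    (hG : DifferentiableOn ℂ G ({z : ℂ | z.re < 0} \ P)) {σ : ℝ} (hσP : ∀ p ∈ P, σ ≤ p.re)
    (hσ : Iio σ ⊆ integrableExpSet id μ)
    (hFG : ∀ z : ℂ, z.re < σ → complexMGF id μ z = G z) :
    Iio 0 ⊆ integrableExpSet id μ := by
  by_contra hcon
  obtain ⟨y, hy0, hy⟩ := not_subset.mp hcon
  have hy0 : y < 0 := hy0
  set S := integrableExpSet id μ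
  have hub : ∀ x ∈ S, x ≤ y := fun x hx => by
    by_contra h
    exact hy (mem_integrableExpSet_of_le hμ (not_le.mp h).le hx)
  have hne : S.Nonempty := ⟨σ - 1, hσ (by simp)⟩
  have hbdd : BddAbove S := ⟨y, hub⟩
  set a := sSup S
  have ha0 : a < 0 := (csSup_le hne hub).trans_lt hy0
  have haS : Iio a ⊆ S := fun x hx => by
    obtain ⟨s, hs, hxs⟩ := exists_lt_of_lt_csSup hne hx
    exact mem_integrableExpSet_of_le hμ hxs.le hs
  have hEq := complexMGF_eqOn_of_differentiableOn hPc hPcl haS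
    (hG.mono fun z hz => ⟨lt_trans hz.1 ha0, hz.2⟩) hσP hFG
  have hopen : IsOpen ({z : ℂ | z.re < 0} \ P) :=
    (isOpen_lt Complex.continuous_re continuous_const).sdiff hPcl
  have haP : (a : ℂ) ∈ {z : ℂ | z.re < 0} \ P :=
    ⟨by simpa using ha0, fun h => hPim _ h (by simp)⟩
  obtain ⟨R, hR, hball⟩ := Metric.isOpen_iff.mp hopen _ haP
  set c := a - R / 4
  have hca : c < a := by simp only [c]; linarith
  have hsub : Metric.ball (c : ℂ) (R / 2) ⊆ Metric.ball (a : ℂ) R := by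
    apply Metric.ball_subset_ball'
    rw [Complex.dist_of_im_eq (by simp)]
    simp only [c, Complex.ofReal_re, Real.dist_eq]
    rw [show a - R / 4 - a = -(R / 4) by ring, abs_neg, abs_of_pos (by linarith)]
    linarith
  have hcP : (c : ℂ) ∈ {z : ℂ | z.re < a} \ P :=
    ⟨by simpa using hca, (hball (hsub (Metric.mem_ball_self (by linarith)))).2⟩
  have hmem := add_mem_integrableExpSet_of_differentiableOn_ball hμ
    (Iio_subset_interior_integrableExpSet haS hca) (hG.mono (hsub.trans hball))
    (hEq.eventuallyEq_of_mem
      (((isOpen_lt Complex.continuous_re continuous_const).sdiff hPcl).mem_nhds hcP))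
    (r := 3 * R / 8) (by linarith) (by linarith)
  have := le_csSup hbdd hmem
  simp only [c] at this
  change a - R / 4 + 3 * R / 8 ≤ a at this
  linarith

lemma tendsto_norm_cofinite_of_summable {J : Type*} {l : J → ℂ} (h0 : ∀ j, l j ≠ 0)
    (hs : Summable fun j => 1 / ‖l j‖ ^ 2) : Tendsto (fun j => ‖l j‖) cofinite atTop := by
  have h1 : Tendsto (fun j => (‖l j‖ ^ 2)⁻¹) cofinite (𝓝[>] 0) := by
    rw [tendsto_nhdsWithin_iff]
    refine ⟨by simpa using hs.tendsto_cofinite_zero, Eventually.of_forall fun j => ?_⟩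
    have := norm_pos_iff.mpr (h0 j)
    simp only [mem_Ioi]
    positivity
  have h2 := Real.tendsto_sqrt_atTop.comp h1.inv_tendsto_nhdsGT_zero
  refine h2.congr fun j => ?_
  simp

/-- A family of complex numbers tending to infinity stays away from any given point, apart from the
members equal to it. -/
lemma exists_pos_eq_or_le_norm_add {J : Type*} {l : J → ℂ}
    (ht : Tendsto (fun j => ‖l j‖) cofinite atTop) (z : ℂ) :
    ∃ r > 0, ∀ j, z + l j = 0 ∨ r ≤ ‖z + l j‖ := by
  have hfin : {j | ¬ ‖z‖ + 1 ≤ ‖l j‖}.Finite := ht.eventually_ge_atTop (‖z‖ + 1)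
  obtain ⟨r, hr, h⟩ : ∃ r > 0, ∀ j ∈ {j | ¬ ‖z‖ + 1 ≤ ‖l j‖}, z + l j = 0 ∨ r ≤ ‖z + l j‖ := by
    generalize {j | ¬ ‖z‖ + 1 ≤ ‖l j‖} = s at hfin
    induction s, hfin using Set.Finite.induction_on with
    | empty => exact ⟨1, one_pos, by simp⟩
    | @insert a s _ _ ih =>
      obtain ⟨r, hr, h⟩ := ih
      by_cases ha : z + l a = 0
      · refine ⟨r, hr, fun j hj => ?_⟩
        rcases hj with rfl | hj
        · exact Or.inl ha
        · exact h j hj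
      · refine ⟨min r ‖z + l a‖, lt_min hr (norm_pos_iff.mpr ha), fun j hj => ?_⟩
        rcases hj with rfl | hj
        · exact Or.inr (min_le_right _ _)
        · exact (h j hj).imp_right (min_le_left _ _).trans
  refine ⟨min r 1, by positivity, fun j => ?_⟩
  by_cases hj : ‖z‖ + 1 ≤ ‖l j‖
  · right
    have : ‖l j‖ ≤ ‖z + l j‖ + ‖z‖ := by
      simpa using norm_sub_le (z + l j) z
    exact (min_le_right _ _).trans (by linarith)
  · exact (h j hj).imp_right (min_le_left _ _).trans

lemma isClosed_range_neg {J : Type*} {l : J → ℂ}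
    (ht : Tendsto (fun j => ‖l j‖) cofinite atTop) : IsClosed (range fun j => -l j) := by
  rw [← isOpen_compl_iff, Metric.isOpen_iff]
  intro z hz
  obtain ⟨r, hr, h⟩ := exists_pos_eq_or_le_norm_add ht z
  refine ⟨r, hr, ?_⟩
  rintro _ hw ⟨j, rfl⟩
  rcases h j with h | h
  · exact hz ⟨j, by linear_combination -h⟩
  · rw [Metric.mem_ball, dist_eq_norm, ← norm_neg] at hw
    apply hw.not_ge
    rwa [neg_sub, sub_neg_eq_add]

/-- The sum of the Laplace transforms (up to sign) over `(T, ∞)` of the exponentials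
`e^{lⱼ t} / lⱼ²`. -/
noncomputable def poleSum {J : Type*} (l : J → ℂ) (T : ℝ) (z : ℂ) : ℂ :=
  ∑' j, Complex.exp ((z + l j) * T) / (z + l j) / l j ^ 2

lemma norm_exp_add_mul_le {θ T : ℝ} {z w l : ℂ} (hl : |l.re| ≤ θ) (hw : ‖w - z‖ ≤ 1) :
    ‖Complex.exp ((w + l) * T)‖ ≤ Real.exp ((‖z‖ + 1 + θ) * |T|) := by
  rw [Complex.norm_exp]
  refine Real.exp_le_exp.mpr ?_
  have h1 : |w.re| ≤ ‖z‖ + 1 := by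
    have : ‖w‖ ≤ ‖w - z‖ + ‖z‖ := by simpa using norm_add_le (w - z) z
    linarith [Complex.abs_re_le_norm w]
  calc ((w + l) * T).re = (w.re + l.re) * T := by simp
    _ ≤ |w.re + l.re| * |T| := by rw [← abs_mul]; exact le_abs_self _
    _ ≤ (‖z‖ + 1 + θ) * |T| := by
      gcongr
      exact (abs_add_le _ _).trans (by linarith)

lemma differentiableAt_poleSum {J : Type*} {l : J → ℂ} (h0 : ∀ j, l j ≠ 0)
    (hs : Summable fun j => 1 / ‖l j‖ ^ 2) {θ : ℝ} (hθ : ∀ j, |(l j).re| ≤ θ) (T : ℝ) {z : ℂ}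
    (hz : ∀ j, z + l j ≠ 0) : DifferentiableAt ℂ (poleSum l T) z := by
  obtain ⟨r, hr, h⟩ := exists_pos_eq_or_le_norm_add (tendsto_norm_cofinite_of_summable h0 hs) z
  have hpos : 0 < min 1 (r / 2) := by positivity
  have hlow : ∀ j, ∀ w ∈ Metric.ball z (min 1 (r / 2)), r / 2 ≤ ‖w + l j‖ := by
    intro j w hw
    have h1 := (h j).resolve_left (hz j)
    have h2 : ‖z + l j‖ ≤ ‖w + l j‖ + ‖w - z‖ := by
      simpa [add_comm] using norm_sub_le (w + l j) (w - z)
    have h3 : ‖w - z‖ < r / 2 := (mem_ball_iff_norm.mp hw).trans_le (min_le_right _ _)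
    linarith
  have hd := Complex.differentiableOn_tsum_of_summable_norm
    (F := fun j w => Complex.exp ((w + l j) * T) / (w + l j) / l j ^ 2)
    (U := Metric.ball z (min 1 (r / 2)))
    (hs.mul_left (Real.exp ((‖z‖ + 1 + θ) * |T|) / (r / 2))) (fun j w hw => ?_)
    Metric.isOpen_ball (fun j w hw => ?_)
  · exact hd.differentiableAt (Metric.ball_mem_nhds z hpos)
  · have : w + l j ≠ 0 := norm_pos_iff.mp ((half_pos hr).trans_le (hlow j w hw))
    have h2 : l j ^ 2 ≠ 0 := pow_ne_zero 2 (h0 j)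
    have : DifferentiableAt ℂ (fun w => Complex.exp ((w + l j) * T) / (w + l j) / l j ^ 2) w := by
      fun_prop (disch := assumption)
    exact this.differentiableWithinAt
  · rw [norm_div, norm_div, norm_pow, div_eq_mul_one_div _ (‖l j‖ ^ 2)]
    gcongr
    · exact norm_exp_add_mul_le (hθ j) ((mem_ball_iff_norm.mp hw).le.trans (min_le_left _ _))
    · exact hlow j w hw

lemma tendsto_sub_mul_poleSum {J : Type*} {l : J → ℂ} (h0 : ∀ j, l j ≠ 0)
    (hs : Summable fun j => 1 / ‖l j‖ ^ 2) {θ : ℝ} (hθ : ∀ j, |(l j).re| ≤ θ) (T : ℝ) (z : ℂ) :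
    Tendsto (fun w => (w - z) * poleSum l T w) (𝓝[≠] z)
      (𝓝 (∑' j, if z + l j = 0 then 1 / l j ^ 2 else 0)) := by
  obtain ⟨r, hr, h⟩ := exists_pos_eq_or_le_norm_add (tendsto_norm_cofinite_of_summable h0 hs) z
  have hpos : 0 < min 1 (r / 2) := by positivity
  simp_rw [poleSum, ← tsum_mul_left]
  refine tendsto_tsum_of_dominated_convergence
    (hs.mul_left (Real.exp ((‖z‖ + 1 + θ) * |T|))) (fun j => ?_) ?_
  · split_ifs with hj
    · have : Tendsto (fun w => Complex.exp ((w + l j) * T) / l j ^ 2) (𝓝[≠] z)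
          (𝓝 (Complex.exp ((z + l j) * T) / l j ^ 2)) := by
        refine Tendsto.mono_left (Continuous.tendsto ?_ z) nhdsWithin_le_nhds
        fun_prop
      rw [hj, zero_mul, Complex.exp_zero] at this
      refine this.congr' ?_
      filter_upwards [self_mem_nhdsWithin] with w hw
      have hw' : w - z ≠ 0 := sub_ne_zero.mpr hw
      rw [show w + l j = w - z by linear_combination hj]
      field_simp
    · have hc : ContinuousAt
          (fun w => (w - z) * (Complex.exp ((w + l j) * T) / (w + l j) / l j ^ 2)) z := by
        have h2 : l j ^ 2 ≠ 0 := pow_ne_zero 2 (h0 j)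
        fun_prop (disch := assumption)
      have := hc.tendsto
      simp only [sub_self, zero_mul] at this
      exact this.mono_left nhdsWithin_le_nhds
  · have hb : ∀ᶠ w in 𝓝[≠] z, w ∈ Metric.ball z (min 1 (r / 2)) :=
      nhdsWithin_le_nhds (Metric.ball_mem_nhds z hpos)
    filter_upwards [hb, self_mem_nhdsWithin] with w hw hwz j
    have h1 : ‖w - z‖ < min 1 (r / 2) := mem_ball_iff_norm.mp hw
    have hw' : 0 < ‖w - z‖ := norm_pos_iff.mpr (sub_ne_zero.mpr hwz)
    have hle : ‖w - z‖ ≤ ‖w + l j‖ := by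
      rcases h j with hj | hj
      · rw [show w + l j = w - z by linear_combination hj]
      · have h2 : ‖z + l j‖ ≤ ‖w + l j‖ + ‖w - z‖ := by
          simpa [add_comm] using norm_sub_le (w + l j) (w - z)
        have h3 := h1.trans_le (min_le_right _ _)
        linarith
    have hE := norm_exp_add_mul_le (T := T) (hθ j) (h1.le.trans (min_le_left _ _))
    rw [show (w - z) * (Complex.exp ((w + l j) * T) / (w + l j) / l j ^ 2)
      = ((w - z) / (w + l j)) * (Complex.exp ((w + l j) * T)) * (1 / l j ^ 2) by ring,
      norm_mul, norm_mul, norm_div, norm_div, norm_pow, norm_one]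
    gcongr
    rw [← one_mul (Real.exp _)]
    gcongr
    exact div_le_one_of_le₀ hle (norm_nonneg _)

lemma tsum_ite_ne_zero {J : Type*} {l : J → ℂ} (h0 : ∀ j, l j ≠ 0)
    (hs : Summable fun j => 1 / ‖l j‖ ^ 2) (j₀ : J) :
    (∑' j, if -l j₀ + l j = 0 then 1 / l j ^ 2 else 0) ≠ 0 := by
  classical
  have hfin : {j | -l j₀ + l j = 0}.Finite := by
    refine Set.Finite.subset ((tendsto_norm_cofinite_of_summable h0 hs).eventually_gt_atTop ‖l j₀‖)
      fun j hj => ?_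
    have hj' : -l j₀ + l j = 0 := hj
    have : l j = l j₀ := by linear_combination hj'
    simp [this]
  rw [tsum_eq_sum (s := hfin.toFinset) (by intro j hj; simp_all)]
  have : ∀ j ∈ hfin.toFinset, (if -l j₀ + l j = 0 then 1 / l j ^ 2 else 0) = 1 / l j₀ ^ 2 := by
    intro j hj
    have hj : -l j₀ + l j = 0 := by simpa using hj
    rw [if_pos hj, show l j = l j₀ by linear_combination hj]
  rw [Finset.sum_congr rfl this, Finset.sum_const, nsmul_eq_mul]
  refine mul_ne_zero (Nat.cast_ne_zero.mpr (Finset.card_ne_zero.mpr ⟨j₀, by simp⟩)) ?_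
  exact one_div_ne_zero (pow_ne_zero 2 (h0 j₀))

lemma norm_exp_div_sq_le {θ t : ℝ} (ht : 0 ≤ t) {l : ℂ} (hl : |l.re| ≤ θ) :
    ‖Complex.exp (l * t) / l ^ 2‖ ≤ Real.exp (θ * t) * (1 / ‖l‖ ^ 2) := by
  rw [norm_div, norm_pow, div_eq_mul_one_div, Complex.norm_exp]
  have : (l * (t : ℂ)).re ≤ θ * t := by
    simp only [Complex.mul_re, Complex.ofReal_re, Complex.ofReal_im, mul_zero, sub_zero]
    exact mul_le_mul_of_nonneg_right ((le_abs_self _).trans hl) ht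
  gcongr

section ExponentialSum

variable {J : Type*} [Countable J] {l : J → ℂ}

lemma measurable_tsum_exp_div_sq :
    Measurable fun t : ℝ => ∑' j, Complex.exp (l j * t) / l j ^ 2 :=
  Measurable.tsum fun j => by fun_prop

lemma integrableOn_tsum_exp_div_sq_mul_exp (hs : Summable fun j => 1 / ‖l j‖ ^ 2) {θ : ℝ}
    (hθ : ∀ j, |(l j).re| ≤ θ) {T : ℝ} (hT : 0 ≤ T) {z : ℂ} (hz : z.re < -θ) :
    IntegrableOn (fun t : ℝ => (∑' j, Complex.exp (l j * t) / l j ^ 2) * Complex.exp (z * t))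
      (Ioi T) := by
  have hneg : θ + z.re < 0 := by linarith
  refine Integrable.mono' ((integrableOn_exp_mul_Ioi hneg T).const_mul (∑' j, 1 / ‖l j‖ ^ 2))
    ((measurable_tsum_exp_div_sq.mul (by fun_prop)).aestronglyMeasurable) ?_
  filter_upwards [ae_restrict_mem measurableSet_Ioi] with t ht
  have ht0 : 0 ≤ t := hT.trans (le_of_lt ht)
  have h1 : ‖∑' j, Complex.exp (l j * t) / l j ^ 2‖
      ≤ Real.exp (θ * t) * ∑' j, 1 / ‖l j‖ ^ 2 := by
    rw [← tsum_mul_left]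
    exact tsum_of_norm_bounded (hs.mul_left _).hasSum fun j => norm_exp_div_sq_le ht0 (hθ j)
  have h2 : ‖Complex.exp (z * t)‖ = Real.exp (z.re * t) := by simp [Complex.norm_exp]
  rw [norm_mul, h2, add_mul, Real.exp_add]
  calc _ ≤ (Real.exp (θ * t) * ∑' j, 1 / ‖l j‖ ^ 2) * Real.exp (z.re * t) := by gcongr
    _ = _ := by ring

lemma integral_tsum_exp_div_sq_mul_exp (hs : Summable fun j => 1 / ‖l j‖ ^ 2) {θ : ℝ}
    (hθ : ∀ j, |(l j).re| ≤ θ) {T : ℝ} (hT : 0 ≤ T) {z : ℂ} (hz : z.re < -θ) :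
    ∫ t in Ioi T, (∑' j, Complex.exp (l j * t) / l j ^ 2) * Complex.exp (z * t)
      = -poleSum l T z := by
  have hre : ∀ j, (z + l j).re < 0 := fun j => by
    have := (le_abs_self _).trans (hθ j)
    rw [Complex.add_re]
    linarith
  have hF : ∀ j (t : ℝ), Complex.exp (l j * t) / l j ^ 2 * Complex.exp (z * t)
      = (1 / l j ^ 2) * Complex.exp ((z + l j) * t) := fun j t => by
    rw [add_mul, Complex.exp_add]
    ring
  have hI : ∀ j, IntegrableOn
      (fun t : ℝ => Complex.exp (l j * t) / l j ^ 2 * Complex.exp (z * t)) (Ioi T) := fun j => by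
    simp_rw [hF]
    exact (integrableOn_exp_mul_complex_Ioi (hre j) T).const_mul _
  have hneg : θ + z.re < 0 := by linarith
  have hsum : Summable fun j =>
      ∫ t in Ioi T, ‖Complex.exp (l j * t) / l j ^ 2 * Complex.exp (z * t)‖ := by
    refine Summable.of_nonneg_of_le (fun j => integral_nonneg fun t => norm_nonneg _) (fun j => ?_)
      (hs.mul_right (∫ t in Ioi T, Real.exp ((θ + z.re) * t)))
    rw [← integral_const_mul]
    refine setIntegral_mono_on (hI j).norm
      ((integrableOn_exp_mul_Ioi hneg T).const_mul _) measurableSet_Ioi fun t ht => ?_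
    have h2 : ‖Complex.exp (z * t)‖ = Real.exp (z.re * t) := by simp [Complex.norm_exp]
    rw [norm_mul, h2, add_mul, Real.exp_add]
    calc _ ≤ (Real.exp (θ * t) * (1 / ‖l j‖ ^ 2)) * Real.exp (z.re * t) := by
            gcongr
            exact norm_exp_div_sq_le (hT.trans (le_of_lt ht)) (hθ j)
      _ = _ := by ring
  simp_rw [← tsum_mul_right]
  rw [← integral_tsum_of_summable_integral_norm hI hsum, poleSum, ← tsum_neg]
  refine tsum_congr fun j => ?_
  simp_rw [hF]
  rw [integral_const_mul, integral_exp_mul_complex_Ioi (hre j)]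
  ring

lemma Iio_zero_subset_integrableExpSet_restrict_Ioi (T : ℝ) :
    Iio 0 ⊆ integrableExpSet id (volume.restrict (Ioi T)) := fun _ hx =>
  integrableOn_exp_mul_Ioi hx T

/-- If a quadratic polynomial plus an absolutely convergent sum of exponentials `e^{lⱼ t} / lⱼ²`
with no real exponent is eventually nonnegative, then no exponent has positive real part. -/
theorem re_nonpos_of_nonneg_exponential_sum (h0 : ∀ j, l j ≠ 0)
    (hs : Summable fun j => 1 / ‖l j‖ ^ 2) {θ : ℝ} (hθ0 : 0 ≤ θ) (hθ : ∀ j, |(l j).re| ≤ θ)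
    (him : ∀ j, (l j).im ≠ 0) (a b : ℂ) {h : ℝ → ℝ}
    (hh : ∀ t, (h t : ℂ) = a * (t : ℂ) ^ 2 + b + ∑' j, Complex.exp (l j * t) / l j ^ 2)
    {T : ℝ} (hT : 0 ≤ T) (hnn : ∀ t, T ≤ t → 0 ≤ h t) (j₀ : J) : (l j₀).re ≤ 0 := by
  have htend := tendsto_norm_cofinite_of_summable h0 hs
  set ν : Measure ℝ := volume.restrict (Ioi T)
  have hν := Iio_subset_interior_integrableExpSet (Iio_zero_subset_integrableExpSet_restrict_Ioi T)
  set P : Set ℂ := range fun j => -l j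
  have hPc : P.Countable := countable_range _
  have hPcl : IsClosed P := isClosed_range_neg htend
  have hPim : ∀ p ∈ P, p.im ≠ 0 := by
    rintro _ ⟨j, rfl⟩
    simpa using him j
  have hPre : ∀ p ∈ P, -θ ≤ p.re := by
    rintro _ ⟨j, rfl⟩
    simpa using (le_abs_self _).trans (hθ j)
  let E : ℂ → ℂ := fun z => a * iteratedDeriv 2 (complexMGF id ν) z + b * complexMGF id ν z
  have hE : ∀ z : ℂ, z.re < 0 → DifferentiableAt ℂ E z := fun z hz =>
    ((hasDerivAt_iteratedDeriv_complexMGF (hν hz) 2).differentiableAt.const_mul a).add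
      ((hasDerivAt_complexMGF (hν hz)).differentiableAt.const_mul b)
  let G : ℂ → ℂ := fun z => E z - poleSum l T z
  have hG : DifferentiableOn ℂ G ({z : ℂ | z.re < 0} \ P) := fun z hz =>
    ((hE z hz.1).sub (differentiableAt_poleSum h0 hs hθ T fun j hj =>
      hz.2 ⟨j, by linear_combination -hj⟩)).differentiableWithinAt
  have hhm : Measurable h := by
    have h1 : Measurable fun t : ℝ => (h t : ℂ) := by
      simp_rw [hh]
      exact Measurable.add (by fun_prop) measurable_tsum_exp_div_sq
    exact Complex.measurable_re.comp h1
  set μ : Measure ℝ := ν.withDensity fun t => ENNReal.ofReal (h t)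
  have hdens : Measurable fun t => ENNReal.ofReal (h t) := hhm.ennreal_ofReal
  have hfin : ∀ᵐ t ∂ν, ENNReal.ofReal (h t) < ⊤ := by simp
  have hνT : ∀ᵐ t ∂ν, T < t := ae_restrict_mem measurableSet_Ioi
  have hμ0 : ∀ᵐ t ∂μ, 0 ≤ t := by
    refine (withDensity_absolutelyContinuous ν _).ae_le ?_
    filter_upwards [hνT] with t ht using hT.trans ht.le
  have hsplit : ∀ z : ℂ, (fun t : ℝ => (h t : ℂ) * Complex.exp (z * t)) = fun t : ℝ =>
      a * ((t : ℂ) ^ 2 * Complex.exp (z * t)) + b * Complex.exp (z * t)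
        + (∑' j, Complex.exp (l j * t) / l j ^ 2) * Complex.exp (z * t) := fun z => by
    ext t
    rw [hh]
    ring
  have hz0 : ∀ {z : ℂ}, z.re < -θ → z.re < 0 := fun hz => by linarith
  have hi2 : ∀ z : ℂ, z.re < 0 →
      Integrable (fun t : ℝ => a * ((t : ℂ) ^ 2 * Complex.exp (z * t))) ν := fun z hz => by
    refine Integrable.const_mul ?_ a
    rw [← integrable_norm_iff (by fun_prop)]
    refine (integrable_pow_mul_exp_of_mem_interior_integrableExpSet (hν hz) 2).congr
      (Eventually.of_forall fun t => ?_)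
    simp [Complex.norm_exp]
  have hi0 : ∀ z : ℂ, z.re < 0 → Integrable (fun t : ℝ => b * Complex.exp (z * t)) ν :=
    fun z hz => (integrableOn_exp_mul_complex_Ioi hz T).const_mul b
  have hI : ∀ z : ℂ, z.re < -θ →
      Integrable (fun t : ℝ => (h t : ℂ) * Complex.exp (z * t)) ν := fun z hz => by
    rw [hsplit]
    exact ((hi2 z (hz0 hz)).add (hi0 z (hz0 hz))).add
      (integrableOn_tsum_exp_div_sq_mul_exp hs hθ hT hz)
  have hFG : ∀ z : ℂ, z.re < -θ → complexMGF id μ z = G z := fun z hz => by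
    have h1 : complexMGF id μ z = ∫ t, (h t : ℂ) * Complex.exp (z * t) ∂ν := by
      rw [complexMGF, integral_withDensity_eq_integral_toReal_smul hdens hfin]
      refine integral_congr_ae ?_
      filter_upwards [hνT] with t ht
      rw [ENNReal.toReal_ofReal (hnn t ht.le)]
      simp
    have h2 : Integrable (fun t : ℝ =>
        a * ((t : ℂ) ^ 2 * Complex.exp (z * t)) + b * Complex.exp (z * t)) ν :=
      (hi2 z (hz0 hz)).add (hi0 z (hz0 hz))
    rw [h1, hsplit, integral_add h2
      (integrableOn_tsum_exp_div_sq_mul_exp hs hθ hT hz), integral_add (hi2 z (hz0 hz))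
      (hi0 z (hz0 hz)), integral_tsum_exp_div_sq_mul_exp hs hθ hT hz, integral_const_mul,
      integral_const_mul]
    have h3 : iteratedDeriv 2 (complexMGF id ν) z = _ := iteratedDeriv_complexMGF (hν (hz0 hz)) 2
    simp only [G, E]
    rw [h3]
    simp only [complexMGF, id]
    ring
  have hσ : Iio (-θ) ⊆ integrableExpSet id μ := fun x hx => by
    refine (integrable_withDensity_iff_integrable_smul' hdens hfin).mpr ?_
    have h1 := (hI (x : ℂ) (by simpa using hx)).norm
    refine h1.congr ?_
    filter_upwards [hνT] with t ht
    rw [ENNReal.toReal_ofReal (hnn t ht.le), norm_mul, Complex.norm_real,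
      Real.norm_of_nonneg (hnn t ht.le), Complex.norm_exp]
    simp
  have hS := Iio_zero_subset_integrableExpSet hμ0 hPc hPcl hPim hG hPre hσ hFG
  have hEq := complexMGF_eqOn_of_differentiableOn hPc hPcl hS hG hPre hFG
  by_contra! hpos
  set p : ℂ := -l j₀
  have hp : p.re < 0 := by simpa [p] using hpos
  have hEp := (hE p hp).continuousAt
  have hFp := (hasDerivAt_complexMGF (Iio_subset_interior_integrableExpSet hS hp)).continuousAt
  have hsub : ContinuousAt (fun z : ℂ => (z - p) * (E z - complexMGF id μ z)) p :=
    (by fun_prop : ContinuousAt (fun z : ℂ => z - p) p).mul (hEp.sub hFp)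
  have hlim0 : Tendsto (fun z => (z - p) * poleSum l T z) (𝓝[≠] p) (𝓝 0) := by
    have h1 := hsub.tendsto.mono_left (nhdsWithin_le_nhds (s := {p}ᶜ))
    simp only [sub_self, zero_mul] at h1
    refine h1.congr' ?_
    obtain ⟨r, hr, hsep⟩ := exists_pos_eq_or_le_norm_add htend p
    filter_upwards [self_mem_nhdsWithin, nhdsWithin_le_nhds (Metric.ball_mem_nhds p hr),
      nhdsWithin_le_nhds ((isOpen_lt Complex.continuous_re continuous_const).mem_nhds hp)]
      with z hzp hzr hz
    have hzP : z ∉ P := by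
      rintro ⟨j, rfl⟩
      rcases hsep j with hj | hj
      · exact hzp (by simp only [mem_singleton_iff]; linear_combination -hj)
      · rw [Metric.mem_ball, dist_eq_norm, ← norm_neg, neg_sub, sub_neg_eq_add] at hzr
        exact hj.not_gt hzr
    rw [hEq ⟨hz, hzP⟩]
    simp only [G]
    ring
  exact tsum_ite_ne_zero h0 hs j₀
    (tendsto_nhds_unique (tendsto_sub_mul_poleSum h0 hs hθ T p) hlim0)

end ExponentialSum

lemma norm_one_sub_mul_exp_sub_one_le {w : ℂ} (hw : ‖w‖ ≤ 1) :
    ‖(1 - w) * Complex.exp w - 1‖ ≤ 3 * ‖w‖ ^ 2 := by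
  have h1 := Complex.norm_exp_sub_one_sub_id_le hw
  have h2 : ‖1 - w‖ ≤ 2 := (norm_sub_le _ _).trans (by rw [norm_one]; linarith)
  calc ‖(1 - w) * Complex.exp w - 1‖ = ‖(1 - w) * (Complex.exp w - 1 - w) - w ^ 2‖ := by
        congr 1; ring
    _ ≤ ‖1 - w‖ * ‖Complex.exp w - 1 - w‖ + ‖w‖ ^ 2 := by
        rw [← norm_mul, ← norm_pow]; exact norm_sub_le _ _
    _ ≤ 2 * ‖w‖ ^ 2 + ‖w‖ ^ 2 := by gcongr
    _ = 3 * ‖w‖ ^ 2 := by ring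

lemma tprod_one_sub_div_mul_exp_eq_zero_iff {I : Type*} {γ : I → ℂ} (hγ : ∀ k, γ k ≠ 0)
    (hsum : Summable fun k => 1 / ‖γ k‖ ^ 2) (z : ℂ) :
    ∏' k, (1 - z / γ k) * Complex.exp (z / γ k) = 0 ↔ ∃ k, γ k = z := by
  constructor
  · contrapose!
    intro hz
    have hs : Summable fun k => ‖(1 - z / γ k) * Complex.exp (z / γ k) - 1‖ := by
      refine Summable.of_norm_bounded_eventually (hsum.mul_left (3 * ‖z‖ ^ 2)) ?_
      filter_upwards [(tendsto_norm_cofinite_of_summable hγ hsum).eventually_ge_atTop ‖z‖]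
        with k hk
      rw [norm_norm]
      refine (norm_one_sub_mul_exp_sub_one_le ?_).trans_eq ?_
      · rw [norm_div]
        exact div_le_one_of_le₀ hk (norm_nonneg _)
      · rw [norm_div]
        ring
    have := tprod_one_add_ne_zero_of_summable
      (f := fun k => (1 - z / γ k) * Complex.exp (z / γ k) - 1) (fun k => ?_) hs
    · simpa using this
    · rw [add_sub_cancel]
      refine mul_ne_zero (fun h => hz k ?_) (Complex.exp_ne_zero _)
      have := hγ k
      field_simp at h
      linear_combination h
  · rintro ⟨k, rfl⟩
    exact tprod_of_exists_eq_zero ⟨k, by simp [hγ k]⟩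

lemma summable_exp_div_sq {I : Type*} {l : I → ℂ} (hsum : Summable fun k => 1 / ‖l k‖ ^ 2)
    {θ : ℝ} (hθ : ∀ k, |(l k).re| ≤ θ) (t : ℝ) :
    Summable fun k => Complex.exp (l k * t) / l k ^ 2 := by
  refine Summable.of_norm_bounded (hsum.mul_left (Real.exp (θ * |t|))) fun k => ?_
  rw [norm_div, norm_pow, div_eq_mul_one_div, Complex.norm_exp]
  have : (l k * (t : ℂ)).re ≤ θ * |t| := by
    simp only [Complex.mul_re, Complex.ofReal_re, Complex.ofReal_im, mul_zero, sub_zero]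
    refine (le_abs_self _).trans ?_
    rw [abs_mul]
    exact mul_le_mul_of_nonneg_right (hθ k) (abs_nonneg t)
  gcongr

theorem im_nonpos_of_screw_nonneg {I : Type*} [Countable I] {B θ : ℝ} {m₀ : ℕ} {γ : I → ℂ}
    (hθ : 0 ≤ θ) (hγ : ∀ k, γ k ≠ 0) (hsum : Summable fun k => 1 / ‖γ k‖ ^ 2)
    (him : ∀ k, |(γ k).im| ≤ θ) (hre : ∀ k, (γ k).re ≠ 0) {T : ℝ} (hT : 0 ≤ T)
    (h : ∀ t : ℝ, T ≤ t →
        0 ≤ (-(-Complex.I * (B : ℂ) * (t : ℂ) - (m₀ : ℂ) / 2 * (t : ℂ) ^ 2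
            + ∑' k, (Complex.exp (-Complex.I * γ k * t) - 1) / (γ k) ^ 2)).re) (k : I) :
    (γ k).im ≤ 0 := by
  let l₀ : I → ℂ := fun k => -Complex.I * γ k
  let l : I ⊕ I → ℂ := Sum.elim l₀ fun k => starRingEnd ℂ (l₀ k)
  have hs₀ : Summable fun k => 1 / ‖l₀ k‖ ^ 2 := by simpa [l₀] using hsum
  have hs : Summable fun j => 1 / ‖l j‖ ^ 2 := by
    refine (HasSum.sum (f := fun j => 1 / ‖l j‖ ^ 2) (a := ∑' k, 1 / ‖l₀ k‖ ^ 2)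
      (b := ∑' k, 1 / ‖l₀ k‖ ^ 2) hs₀.hasSum ?_).summable
    refine hs₀.hasSum.congr_fun fun k => ?_
    simp [l]
  have hθ₀ : ∀ k, |(l₀ k).re| ≤ θ := fun k => by simpa [l₀] using him k
  let S : ℝ → ℂ := fun t => ∑' k, Complex.exp (l₀ k * t) / l₀ k ^ 2
  let b : ℂ := ∑' k, 1 / l₀ k ^ 2
  have hb : Summable fun k => 1 / l₀ k ^ 2 :=
    Summable.of_norm (by simpa using hs₀)
  have hS : ∀ t : ℝ, ∑' k, (Complex.exp (-Complex.I * γ k * t) - 1) / (γ k) ^ 2 = b - S t := by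
    intro t
    rw [← hb.tsum_sub (summable_exp_div_sq hs₀ hθ₀ t)]
    refine tsum_congr fun k => ?_
    simp only [l₀, mul_pow, neg_sq, Complex.I_sq]
    have := hγ k
    field_simp
    ring
  have hl : ∀ t : ℝ, ∑' j, Complex.exp (l j * t) / l j ^ 2 = S t + starRingEnd ℂ (S t) := by
    intro t
    have h1 := summable_exp_div_sq hs₀ hθ₀ t
    have h2 : ∀ k, Complex.exp (starRingEnd ℂ (l₀ k) * t) / starRingEnd ℂ (l₀ k) ^ 2
        = starRingEnd ℂ (Complex.exp (l₀ k * t) / l₀ k ^ 2) := fun k => by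
      rw [map_div₀, map_pow, ← Complex.exp_conj,
        map_mul (starRingEnd ℂ) (l₀ k) (t : ℂ), Complex.conj_ofReal]
    have h3 : HasSum (fun k => starRingEnd ℂ (Complex.exp (l₀ k * t) / l₀ k ^ 2))
        (starRingEnd ℂ (S t)) := Complex.hasSum_conj'.mpr (by simpa using h1.hasSum)
    refine HasSum.tsum_eq (HasSum.sum ?_ ?_)
    · exact h1.hasSum
    · rw [← funext h2] at h3
      exact h3
  have key := re_nonpos_of_nonneg_exponential_sum (l := l) (θ := θ) ?_ hs hθ ?_ ?_ (m₀ : ℂ)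
    (-(b + starRingEnd ℂ b)) (h := fun t => 2 *
      (-(-Complex.I * (B : ℂ) * (t : ℂ) - (m₀ : ℂ) / 2 * (t : ℂ) ^ 2 + (b - S t))).re) ?_ hT ?_
    (Sum.inl k)
  · simpa [l, l₀] using key
  · rintro (k | k) <;> simp [l, l₀, hγ]
  · rintro (k | k) <;> simpa [l, l₀] using him k
  · rintro (k | k) <;> simpa [l, l₀] using hre k
  · intro t
    rw [hl, ← Complex.add_conj]
    simp [map_ofNat]
    ring
  · intro t ht
    have := h t ht
    rw [hS] at this
    positivity

lemma screw_nonneg_of_im_eq_zero {I : Type*} {γ : I → ℂ} (B : ℝ) (m₀ : ℕ)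
    (hγ : ∀ k, (γ k).im = 0) (t : ℝ) :
    0 ≤ (-(-Complex.I * (B : ℂ) * (t : ℂ) - (m₀ : ℂ) / 2 * (t : ℂ) ^ 2
            + ∑' k, (Complex.exp (-Complex.I * γ k * t) - 1) / (γ k) ^ 2)).re := by
  have hterm : ∀ k, ((Complex.exp (-Complex.I * γ k * t) - 1) / (γ k) ^ 2).re ≤ 0 := by
    intro k
    obtain ⟨x, hx⟩ : ∃ x : ℝ, γ k = x := ⟨(γ k).re, Complex.ext rfl (by simpa using hγ k)⟩
    rw [hx, ← Complex.ofReal_pow, Complex.div_ofReal_re]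
    refine div_nonpos_of_nonpos_of_nonneg ?_ (sq_nonneg x)
    rw [show -Complex.I * (x : ℂ) * t = ((-(x * t) : ℝ) : ℂ) * Complex.I by push_cast; ring,
      Complex.sub_re, Complex.exp_ofReal_mul_I_re, Complex.one_re]
    linarith [Real.cos_le_one (-(x * t))]
  have hre : (∑' k, (Complex.exp (-Complex.I * γ k * t) - 1) / (γ k) ^ 2).re ≤ 0 := by
    by_cases hs : Summable fun k => (Complex.exp (-Complex.I * γ k * t) - 1) / (γ k) ^ 2
    · rw [Complex.re_tsum hs]
      exact tsum_nonpos hterm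
    · rw [tsum_eq_zero_of_not_summable hs, Complex.zero_re]
  have hquad : (-Complex.I * (B : ℂ) * (t : ℂ) - (m₀ : ℂ) / 2 * (t : ℂ) ^ 2).re
      = -((m₀ : ℝ) / 2 * t ^ 2) := by
    rw [show -Complex.I * (B : ℂ) * (t : ℂ) - (m₀ : ℂ) / 2 * (t : ℂ) ^ 2
      = ((-((m₀ : ℝ) / 2 * t ^ 2) : ℝ) : ℂ) + ((-(B * t) : ℝ) : ℂ) * Complex.I by
        push_cast; ring]
    simp [-Complex.ofReal_neg, -Complex.ofReal_mul, -Complex.ofReal_div, -Complex.ofReal_pow]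
  rw [Complex.neg_re, Complex.add_re, hquad]
  have : 0 ≤ (m₀ : ℝ) / 2 * t ^ 2 := by positivity
  linarith
/-- main theorem, abstract form: Let `ξ` be entire with
`ξ(s) = ω conj(ξ(1 − conj s))`, `|ω| = 1`, admitting the Hadamard product
`ξ(1/2 − iz) = e^{A+Bz} z^{m₀} Πₖ (1 − z/γₖ) e^{z/γₖ}` with `B` real, the nonzero
zeros `γₖ` satisfying `Σ 1/|γₖ|² < ∞`, `|Im γₖ| ≤ θ`, and `Re γₖ ≠ 0` for every `k`
(no real zeros except possibly at `s = 1/2`). Then all `γₖ` are real (GRH) if and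
only if there exists `t₀ ≥ 0` with `Re(−g(t)) ≥ 0` for all `t ≥ t₀`, where
`g(t) = −iBt − (m₀/2)t² + Σₖ (e^{−iγₖt} − 1)/γₖ²`. -/
theorem grh_iff_screw_nonneg {I : Type*} [Countable I] (ξ : ℂ → ℂ) (ω A : ℂ) (B θ : ℝ)
    (m₀ : ℕ) (γ : I → ℂ)
    (hξ : Differentiable ℂ ξ) (hω : ‖ω‖ = 1)
    (hfe : ∀ s : ℂ, ξ s = ω * (starRingEnd ℂ) (ξ (1 - (starRingEnd ℂ) s)))
    (hθ : 0 ≤ θ) (hγ : ∀ k, γ k ≠ 0)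
    (hsum : Summable fun k => 1 / ‖γ k‖ ^ 2)
    (him : ∀ k, |(γ k).im| ≤ θ)
    (hmul : ∀ z : ℂ, Multipliable fun k => (1 - z / γ k) * Complex.exp (z / γ k))
    (hprod : ∀ z : ℂ, ξ (1 / 2 - Complex.I * z)
      = Complex.exp (A + (B : ℂ) * z) * z ^ m₀
          * ∏' k, (1 - z / γ k) * Complex.exp (z / γ k))
    (hre : ∀ k, (γ k).re ≠ 0) :
    (∀ k, (γ k).im = 0) ↔
      ∃ t₀ : ℝ, 0 ≤ t₀ ∧ ∀ t : ℝ, t₀ ≤ t →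
        0 ≤ (-(-Complex.I * (B : ℂ) * (t : ℂ) - (m₀ : ℂ) / 2 * (t : ℂ) ^ 2
            + ∑' k, (Complex.exp (-Complex.I * γ k * t) - 1) / (γ k) ^ 2)).re := by
  refine ⟨fun h => ⟨0, le_rfl, fun t _ => screw_nonneg_of_im_eq_zero B m₀ h t⟩, ?_⟩
  rintro ⟨T, hT, h⟩ k
  have hle := im_nonpos_of_screw_nonneg hθ hγ hsum him hre hT h
  have hzero : ∀ z : ℂ, z ≠ 0 → (ξ (1 / 2 - Complex.I * z) = 0 ↔ ∃ j, γ j = z) := by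
    intro z hz
    rw [hprod, ← tprod_one_sub_div_mul_exp_eq_zero_iff hγ hsum, mul_eq_zero,
      or_iff_right (mul_ne_zero (Complex.exp_ne_zero _) (pow_ne_zero _ hz))]
  obtain ⟨j, hj⟩ : ∃ j, γ j = starRingEnd ℂ (γ k) := by
    rw [← hzero _ (by simpa using hγ k), hfe]
    have hk := (hzero _ (hγ k)).mpr ⟨k, rfl⟩
    have harg : 1 - starRingEnd ℂ (1 / 2 - Complex.I * starRingEnd ℂ (γ k))
        = 1 / 2 - Complex.I * γ k := by
      simp only [map_sub, map_mul, map_div₀, map_one, Complex.conj_I, Complex.conj_conj,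
        map_ofNat]
      ring
    rw [harg, hk, map_zero, mul_zero]
  refine le_antisymm (hle k) ?_
  have := hle j
  rw [hj, Complex.conj_im] at this
  linarith
end

section
/- For every complex number z with Im z > θ, one has 2 ∫₀^∞ Re(g(t)) e^{izt} dt = (i/z²) [ 2 m₀/z + Σₖ (1/(z − γₖ) + 1/γₖ) + Σₖ (1/(z + conj(γₖ)) − 1/conj(γₖ)) ], both series converging absolutely. -/
open MeasureTheory

namespace ScrewFunction

open Complex Set

lemma norm_term_le {γ z : ℂ} {θ t : ℝ} (h : |γ.im| ≤ θ) (ht : 0 < t) :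
    ‖(exp (-I * γ * t) - 1) / γ ^ 2 * exp (I * z * t)‖ ≤
      1 / ‖γ‖ ^ 2 * (Real.exp ((θ - z.im) * t) + Real.exp (-z.im * t)) := by
  have h1 : ‖exp (-I * γ * t) - 1‖ ≤ Real.exp (θ * t) + 1 := by
    refine (norm_sub_le _ _).trans ?_
    rw [norm_exp, norm_one]
    have : (-I * γ * t).re = γ.im * t := by simp
    rw [this]
    gcongr
    exact (le_abs_self _).trans h
  have h2 : ‖exp (I * z * t)‖ = Real.exp (-z.im * t) := by
    rw [norm_exp]
    simp
  rw [norm_mul, norm_div, norm_pow, h2]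
  calc ‖exp (-I * γ * t) - 1‖ / ‖γ‖ ^ 2 * Real.exp (-z.im * t)
      ≤ (Real.exp (θ * t) + 1) / ‖γ‖ ^ 2 * Real.exp (-z.im * t) := by gcongr
    _ = 1 / ‖γ‖ ^ 2 * (Real.exp (θ * t) * Real.exp (-z.im * t) + Real.exp (-z.im * t)) := by ring
    _ = _ := by rw [← Real.exp_add]; ring_nf

lemma integrableOn_bound {θ y : ℝ} (hθ : 0 ≤ θ) (hy : θ < y) :
    IntegrableOn (fun t : ℝ => Real.exp ((θ - y) * t) + Real.exp (-y * t)) (Ioi 0) :=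
  (integrableOn_exp_mul_Ioi (by linarith) 0).add (integrableOn_exp_mul_Ioi (by linarith) 0)

lemma integrableOn_term {γ z : ℂ} {θ : ℝ} (hθ : 0 ≤ θ) (h : |γ.im| ≤ θ) (hz : θ < z.im) :
    IntegrableOn (fun t : ℝ => (exp (-I * γ * t) - 1) / γ ^ 2 * exp (I * z * t)) (Ioi 0) := by
  refine ((integrableOn_bound hθ hz).const_mul (1 / ‖γ‖ ^ 2)).mono' ?_ ?_
  · exact Continuous.aestronglyMeasurable (by fun_prop)
  · exact (ae_restrict_mem measurableSet_Ioi).mono fun t ht => norm_term_le h ht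

lemma integral_term {γ z : ℂ} {θ : ℝ} (hθ : 0 ≤ θ) (hγ : γ ≠ 0) (h : |γ.im| ≤ θ)
    (hz : θ < z.im) :
    ∫ t in Ioi (0 : ℝ), (exp (-I * γ * t) - 1) / γ ^ 2 * exp (I * z * t) =
      I / z ^ 2 * (1 / (z - γ) + 1 / γ) := by
  have him : γ.im ≤ θ := (le_abs_self _).trans h
  have h1 : (I * (z - γ)).re < 0 := by simp; linarith
  have h2 : (I * z).re < 0 := by simp; linarith
  have hz0 : z ≠ 0 := by rintro rfl; simp at h2
  have hzγ : z - γ ≠ 0 := by intro h0; simp [h0] at h1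
  have heq (t : ℝ) : (exp (-I * γ * t) - 1) / γ ^ 2 * exp (I * z * t) =
      1 / γ ^ 2 * (exp (I * (z - γ) * t) - exp (I * z * t)) := by
    have : I * (z - γ) * t = -I * γ * t + I * z * t := by ring
    rw [this, exp_add]
    ring
  simp_rw [heq]
  rw [integral_const_mul, integral_sub (integrableOn_exp_mul_complex_Ioi h1 0)
    (integrableOn_exp_mul_complex_Ioi h2 0), integral_exp_mul_complex_Ioi h1,
    integral_exp_mul_complex_Ioi h2]
  simp only [ofReal_zero, mul_zero, exp_zero]
  field_simp
  simp only [I_sq]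
  ring

lemma integrableOn_tsum {J : Type*} {γ : J → ℂ} {z : ℂ} {θ : ℝ} (hθ : 0 ≤ θ)
    (hsum : Summable fun k => 1 / ‖γ k‖ ^ 2) (him : ∀ k, |(γ k).im| ≤ θ) (hz : θ < z.im) :
    IntegrableOn (fun t : ℝ => (∑' k, (exp (-I * γ k * t) - 1) / (γ k) ^ 2) * exp (I * z * t))
      (Ioi 0) := by
  simp_rw [← tsum_mul_right]
  refine ((integrableOn_bound hθ hz).const_mul (∑' k, 1 / ‖γ k‖ ^ 2)).mono' ?_ ?_
  · refine ContinuousOn.aestronglyMeasurable ?_ measurableSet_Ioi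
    refine continuousOn_tsum (u := fun k => 1 / ‖γ k‖ ^ 2 * 2)
      (fun k => Continuous.continuousOn (by fun_prop)) (hsum.mul_right _) fun k t ht => ?_
    refine (norm_term_le (him k) ht).trans ?_
    have ht : 0 < t := ht
    have h1 : Real.exp ((θ - z.im) * t) ≤ 1 := Real.exp_le_one_iff.2 (by nlinarith)
    have h2 : Real.exp (-z.im * t) ≤ 1 := Real.exp_le_one_iff.2 (by nlinarith)
    gcongr
    linarith
  · refine (ae_restrict_mem measurableSet_Ioi).mono fun t ht => ?_
    rw [← tsum_mul_right]
    exact tsum_of_norm_bounded (hsum.mul_right _).hasSum fun k => norm_term_le (him k) ht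

lemma hasSum_integral {J : Type*} [Countable J] {γ : J → ℂ} {z : ℂ} {θ : ℝ} (hθ : 0 ≤ θ)
    (hγ : ∀ k, γ k ≠ 0) (hsum : Summable fun k => 1 / ‖γ k‖ ^ 2)
    (him : ∀ k, |(γ k).im| ≤ θ) (hz : θ < z.im) :
    HasSum (fun k => I / z ^ 2 * (1 / (z - γ k) + 1 / γ k))
      (∫ t in Ioi (0 : ℝ), (∑' k, (exp (-I * γ k * t) - 1) / (γ k) ^ 2) * exp (I * z * t)) := by
  simp_rw [← tsum_mul_right, ← fun k => integral_term hθ (hγ k) (him k) hz]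
  refine hasSum_integral_of_summable_integral_norm
    (fun k => integrableOn_term hθ (him k) hz) ?_
  refine (hsum.mul_right (∫ t in Ioi (0 : ℝ),
    (Real.exp ((θ - z.im) * t) + Real.exp (-z.im * t)))).of_nonneg_of_le
    (fun k => integral_nonneg fun t => norm_nonneg _) fun k => ?_
  rw [← integral_const_mul]
  exact setIntegral_mono_on (integrableOn_term hθ (him k) hz).norm
    ((integrableOn_bound hθ hz).const_mul _) measurableSet_Ioi fun t ht => norm_term_le (him k) ht

lemma norm_pow_mul_exp {z : ℂ} {t : ℝ} (ht : 0 < t) (n : ℕ) :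
    ‖(t : ℂ) ^ n * exp (I * z * t)‖ = t ^ (n : ℝ) * Real.exp (-z.im * t) := by
  rw [norm_mul, norm_exp, norm_pow, norm_real, Real.norm_of_nonneg ht.le, Real.rpow_natCast]
  simp

lemma integrableOn_pow_mul_exp {z : ℂ} (hz : 0 < z.im) (n : ℕ) :
    IntegrableOn (fun t : ℝ => (t : ℂ) ^ n * exp (I * z * t)) (Ioi 0) := by
  have h := integrableOn_rpow_mul_exp_neg_mul_rpow (s := n) (p := 1) (b := z.im)
    (by linarith [n.cast_nonneg (α := ℝ)]) one_pos hz
  refine h.mono' (Continuous.aestronglyMeasurable (by fun_prop)) ?_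
  refine (ae_restrict_mem measurableSet_Ioi).mono fun t ht => ?_
  rw [norm_pow_mul_exp ht, Real.rpow_one]

lemma tendsto_pow_mul_exp {z : ℂ} (hz : 0 < z.im) (n : ℕ) :
    Filter.Tendsto (fun t : ℝ => (t : ℂ) ^ n * exp (I * z * t)) Filter.atTop (nhds 0) := by
  rw [tendsto_zero_iff_norm_tendsto_zero]
  refine (tendsto_rpow_mul_exp_neg_mul_atTop_nhds_zero n z.im hz).congr' ?_
  filter_upwards [Filter.eventually_gt_atTop 0] with t ht
  rw [norm_pow_mul_exp ht]

lemma integral_sq_mul_exp {z : ℂ} (hz : 0 < z.im) :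
    ∫ t in Ioi (0 : ℝ), (t : ℂ) ^ 2 * exp (I * z * t) = -2 * I / z ^ 3 := by
  have hz0 : z ≠ 0 := by rintro rfl; simp at hz
  set a : ℂ := I * z with ha
  have ha0 : a ≠ 0 := mul_ne_zero I_ne_zero hz0
  have hderiv (t : ℝ) : HasDerivAt (fun t : ℝ => 1 / a * ((t : ℂ) ^ 2 * exp (a * t))
      - 2 / a ^ 2 * ((t : ℂ) ^ 1 * exp (a * t)) + 2 / a ^ 3 * ((t : ℂ) ^ 0 * exp (a * t)))
      ((t : ℂ) ^ 2 * exp (a * t)) t := by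
    have hid : HasDerivAt (fun t : ℝ => (t : ℂ)) 1 t := ofRealCLM.hasDerivAt
    have hexp := (hid.const_mul a).cexp
    refine (((((hid.pow 2).mul hexp).const_mul (1 / a)).sub
      (((hid.pow 1).mul hexp).const_mul (2 / a ^ 2))).add
      (((hid.pow 0).mul hexp).const_mul (2 / a ^ 3))).congr_deriv ?_
    simp
    field_simp
    ring
  have hlim := ((((tendsto_pow_mul_exp hz 2).const_mul (1 / a)).sub
    ((tendsto_pow_mul_exp hz 1).const_mul (2 / a ^ 2))).add
    ((tendsto_pow_mul_exp hz 0).const_mul (2 / a ^ 3)))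
  rw [integral_Ioi_of_hasDerivAt_of_tendsto' (fun t _ => hderiv t)
    (integrableOn_pow_mul_exp hz 2) hlim]
  have h3 : a ^ 3 = -I * z ^ 3 := by rw [ha, mul_pow, I_pow_three]
  simp [h3]
  field_simp
  simp

end ScrewFunction

/-- For every complex `z` with `Im z > θ`,
`2 ∫₀^∞ Re(g(t)) e^{izt} dt
  = (i/z²)[ 2m₀/z + Σₖ (1/(z − γₖ) + 1/γₖ) + Σₖ (1/(z + conj γₖ) − 1/conj γₖ) ]`,
both series converging absolutely, where
`g(t) = −iBt − (m₀/2)t² + Σₖ (e^{−iγₖt} − 1)/γₖ²`. -/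
theorem integral_re_screw_function {I : Type*} [Countable I] (B θ : ℝ) (m₀ : ℕ)
    (γ : I → ℂ) (hθ : 0 ≤ θ) (hγ : ∀ k, γ k ≠ 0)
    (hsum : Summable fun k => 1 / ‖γ k‖ ^ 2)
    (him : ∀ k, |(γ k).im| ≤ θ) :
    ∀ z : ℂ, θ < z.im →
      (Summable fun k => ‖1 / (z - γ k) + 1 / γ k‖) ∧
      (Summable fun k => ‖1 / (z + (starRingEnd ℂ) (γ k)) - 1 / (starRingEnd ℂ) (γ k)‖) ∧
      2 * (∫ t in Set.Ioi (0 : ℝ),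
          (((-Complex.I * (B : ℂ) * (t : ℂ) - (m₀ : ℂ) / 2 * (t : ℂ) ^ 2
              + ∑' k, (Complex.exp (-Complex.I * γ k * t) - 1) / (γ k) ^ 2).re : ℝ) : ℂ) *
            Complex.exp (Complex.I * z * t))
        = Complex.I / z ^ 2 *
            (2 * (m₀ : ℂ) / z + (∑' k, (1 / (z - γ k) + 1 / γ k))
              + ∑' k, (1 / (z + (starRingEnd ℂ) (γ k)) - 1 / (starRingEnd ℂ) (γ k))) := by
  intro z hz
  have hγ' : ∀ k, -(starRingEnd ℂ) (γ k) ≠ 0 := by simpa using hγ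
  have hsum' : Summable fun k => 1 / ‖-(starRingEnd ℂ) (γ k)‖ ^ 2 := by simpa using hsum
  have him' : ∀ k, |(-(starRingEnd ℂ) (γ k)).im| ≤ θ := by simpa using him
  have hz0 : z ≠ 0 := by rintro rfl; simp at hz; linarith
  have hc : Complex.I / z ^ 2 ≠ 0 := by simp [hz0]
  have H1 := ScrewFunction.hasSum_integral hθ hγ hsum him hz
  have H2 := ScrewFunction.hasSum_integral hθ hγ' hsum' him' hz
  have I1 := ScrewFunction.integrableOn_tsum hθ hsum him hz
  have I2 := ScrewFunction.integrableOn_tsum hθ hsum' him' hz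
  have I3 := (ScrewFunction.integrableOn_pow_mul_exp (hθ.trans_lt hz) 2).const_mul (-(m₀ : ℂ))
  have hterm (k : I) : 1 / (z - -(starRingEnd ℂ) (γ k)) + 1 / -(starRingEnd ℂ) (γ k) =
      1 / (z + (starRingEnd ℂ) (γ k)) - 1 / (starRingEnd ℂ) (γ k) := by
    rw [sub_neg_eq_add, div_neg, ← sub_eq_add_neg]
  simp_rw [hterm] at H2
  refine ⟨((summable_mul_left_iff hc).1 H1.summable).norm,
    ((summable_mul_left_iff hc).1 H2.summable).norm, ?_⟩
  have key : ∀ t ∈ Set.Ioi (0 : ℝ),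
      2 * ((((-Complex.I * (B : ℂ) * (t : ℂ) - (m₀ : ℂ) / 2 * (t : ℂ) ^ 2
              + ∑' k, (Complex.exp (-Complex.I * γ k * t) - 1) / (γ k) ^ 2).re : ℝ) : ℂ) *
            Complex.exp (Complex.I * z * t)) =
        -(m₀ : ℂ) * ((t : ℂ) ^ 2 * Complex.exp (Complex.I * z * t)) +
        ((∑' k, (Complex.exp (-Complex.I * γ k * t) - 1) / (γ k) ^ 2) *
            Complex.exp (Complex.I * z * t) +
          (∑' k, (Complex.exp (-Complex.I * -(starRingEnd ℂ) (γ k) * t) - 1) /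
              (-(starRingEnd ℂ) (γ k)) ^ 2) * Complex.exp (Complex.I * z * t)) := by
    intro t _
    have hconj : (∑' k, (Complex.exp (-Complex.I * -(starRingEnd ℂ) (γ k) * t) - 1) /
        (-(starRingEnd ℂ) (γ k)) ^ 2) = (starRingEnd ℂ)
          (∑' k, (Complex.exp (-Complex.I * γ k * t) - 1) / (γ k) ^ 2) := by
      rw [Complex.conj_tsum]
      refine tsum_congr fun k => ?_
      simp [← Complex.exp_conj]
    rw [hconj, Complex.re_eq_add_conj]
    simp only [map_add, map_sub, map_mul, map_neg, map_div₀, map_pow, Complex.conj_I,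
      Complex.conj_ofReal, map_natCast, map_ofNat]
    ring
  rw [← integral_const_mul, setIntegral_congr_fun measurableSet_Ioi key,
    integral_add I3 (by exact I1.add I2), integral_add I1 I2, integral_const_mul,
    ScrewFunction.integral_sq_mul_exp (hθ.trans_lt hz), ← H1.tsum_eq, ← H2.tsum_eq,
    tsum_mul_left, tsum_mul_left]
  field_simp
  ring
end
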